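/- arXiv:1703.03499 — 4 statements merged into one kernel-verified Lean document; each statement's English description precedes it below -/
import Mathlib

section
/- Let N_t > 2 be an integer and let λ₁ > λ₂ > 0 be real numbers. Let v = (v₁, …, v_{N_t}) be a random vector uniformly distributed on the unit sphere {v ∈ ℂ^{N_t} : ‖v‖ = 1} (i.e., distributed according to the normalized rotation-invariant surface measure). Then for every x with 0 ≤ x ≤ λ₂, the probability P(λ₁|v₁|² + λ₂|v₂|² ≤ x) equals 1 − (λ₁/(λ₁−λ₂))·(1 − x/λ₁)^{N_t−1} + (λ₂/(λ₁−λ₂))·(1 − x/λ₂)^{N_t−1}. -/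
open MeasureTheory


lemma aux_borel (n : ℕ) :
    WithLp.measurableSpace 2 (Fin (n+2) → ℂ) = borel (EuclideanSpace ℂ (Fin (n+2))) :=
  BorelSpace.measurable_eq

lemma aux_trans {n : ℕ} (u v : EuclideanSpace ℂ (Fin (n+1))) (hu : ‖u‖ = 1) (hv : ‖v‖ = 1) :
    ∃ U : EuclideanSpace ℂ (Fin (n+1)) ≃ₗᵢ[ℂ] EuclideanSpace ℂ (Fin (n+1)), U u = v := by
  have key : ∀ w : EuclideanSpace ℂ (Fin (n+1)), ‖w‖ = 1 →
      ∃ b : OrthonormalBasis (Fin (n+1)) ℂ (EuclideanSpace ℂ (Fin (n+1))), b 0 = w := by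
    intro w hw
    obtain ⟨b, hb⟩ := Orthonormal.exists_orthonormalBasis_extension_of_card_eq (𝕜 := ℂ)
      (E := EuclideanSpace ℂ (Fin (n+1))) (ι := Fin (n+1)) (by simp) (v := fun _ => w) (s := {0})
      (by
        constructor
        · intro i; simpa using hw
        · intro i j hij
          exact absurd (Subsingleton.elim i j) hij)
    exact ⟨b, hb 0 rfl⟩
  obtain ⟨b, hb⟩ := key u hu
  obtain ⟨b', hb'⟩ := key v hv
  refine ⟨b.equiv b' (Equiv.refl _), ?_⟩
  rw [← hb, ← hb']
  simp

/-- real inner product is invariant -/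
lemma aux_inner {n : ℕ} (U : EuclideanSpace ℂ (Fin (n+1)) ≃ₗᵢ[ℂ] EuclideanSpace ℂ (Fin (n+1)))
    (x y : EuclideanSpace ℂ (Fin (n+1))) : inner ℝ (U x) (U y) = inner ℝ x y := by
  have h : ∀ x y : EuclideanSpace ℂ (Fin (n+1)), inner ℝ x y = (inner ℂ x y).re := by
    intro x y
    simp [PiLp.inner_apply, Complex.inner]
  rw [h, h, U.inner_map_map]

lemma aux_charFun_inv {n : ℕ} (μ : Measure (EuclideanSpace ℂ (Fin (n+1))))
    (U : EuclideanSpace ℂ (Fin (n+1)) ≃ₗᵢ[ℂ] EuclideanSpace ℂ (Fin (n+1)))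
    (t : EuclideanSpace ℂ (Fin (n+1))) :
    charFun (μ.map U) (U t) = charFun μ t := by
  simp only [charFun_apply]
  rw [integral_map (by fun_prop) (by fun_prop)]
  simp only [aux_inner]

lemma aux_charFun_radial {n : ℕ} (μ : Measure (EuclideanSpace ℂ (Fin (n+1))))
    (hinv : ∀ U : EuclideanSpace ℂ (Fin (n+1)) ≃ₗᵢ[ℂ] EuclideanSpace ℂ (Fin (n+1)),
      Measure.map (⇑U) μ = μ) (t u : EuclideanSpace ℂ (Fin (n+1))) (hu : ‖u‖ = 1) :
    charFun μ (‖t‖ • u) = charFun μ t := by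
  by_cases ht : t = 0
  · simp [ht]
  have ht' : ‖t‖ ≠ 0 := by simpa using ht
  obtain ⟨U, hU⟩ := aux_trans u ((‖t‖⁻¹ : ℝ) • t) hu (by
    rw [norm_smul, norm_inv, norm_norm, inv_mul_cancel₀ ht'])
  have h1 : U (‖t‖ • u) = t := by
    have : (‖t‖ • u) = ((‖t‖ : ℂ)) • u := by ext i; simp
    rw [this, map_smul, hU]
    ext i
    have : (‖t‖ : ℂ) ≠ 0 := by exact_mod_cast ht'
    simp
    field_simp
  rw [← aux_charFun_inv μ U, hinv U, h1]

lemma aux_unique {n : ℕ} (μ ν : Measure (EuclideanSpace ℂ (Fin (n+1))))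
    [IsProbabilityMeasure μ] [IsProbabilityMeasure ν]
    (hμ : ∀ᵐ v ∂μ, ‖v‖ = 1) (hν : ∀ᵐ v ∂ν, ‖v‖ = 1)
    (hμi : ∀ U : EuclideanSpace ℂ (Fin (n+1)) ≃ₗᵢ[ℂ] EuclideanSpace ℂ (Fin (n+1)),
      Measure.map (⇑U) μ = μ)
    (hνi : ∀ U : EuclideanSpace ℂ (Fin (n+1)) ≃ₗᵢ[ℂ] EuclideanSpace ℂ (Fin (n+1)),
      Measure.map (⇑U) ν = ν) : μ = ν := by
  apply Measure.ext_of_charFun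
  ext t
  have h1 : charFun μ t = ∫ u, charFun μ (‖t‖ • u) ∂ν := by
    have : ∀ᵐ u ∂ν, charFun μ (‖t‖ • u) = charFun μ t := by
      filter_upwards [hν] with u hu using aux_charFun_radial μ hμi t u hu
    rw [integral_congr_ae this]; simp
  have h2 : charFun ν t = ∫ u, charFun ν (‖t‖ • u) ∂μ := by
    have : ∀ᵐ u ∂μ, charFun ν (‖t‖ • u) = charFun ν t := by
      filter_upwards [hμ] with u hu using aux_charFun_radial ν hνi t u hu
    rw [integral_congr_ae this]; simp
  rw [h1, h2]
  simp only [charFun_apply]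
  rw [integral_integral_swap]
  · simp only [real_inner_smul_right, real_inner_comm]
  · apply Integrable.of_bound (C := 1)
    · apply Continuous.aestronglyMeasurable
      simp only [Function.uncurry_def]
      fun_prop
    · filter_upwards with x
      simp [Function.uncurry, Complex.norm_exp]

noncomputable def epsM : Measure ℝ :=
  (volume.restrict (Set.Ioi 0)).withDensity (fun u => ENNReal.ofReal (Real.exp (-u)))

noncomputable def gamM : Measure ℂ :=
  volume.withDensity (fun z => ENNReal.ofReal (Real.exp (-‖z‖^2) / Real.pi))

lemma epsM_lintegral (f : ℝ → ENNReal) (hf : Measurable f) :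
    ∫⁻ u, f u ∂epsM = ∫⁻ u in Set.Ioi 0, ENNReal.ofReal (Real.exp (-u)) * f u := by
  rw [epsM, lintegral_withDensity_eq_lintegral_mul _ (by fun_prop) hf]
  rfl

lemma gamM_lintegral (f : ℂ → ENNReal) (hf : Measurable f) :
    ∫⁻ u, f u ∂gamM = ∫⁻ z, ENNReal.ofReal (Real.exp (-‖z‖^2) / Real.pi) * f z := by
  rw [gamM, lintegral_withDensity_eq_lintegral_mul _ (by fun_prop) hf]
  rfl

lemma gamM_map : gamM.map (fun z => ‖z‖^2) = epsM := by
  apply Measure.ext_of_lintegral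
  intro f hf
  rw [lintegral_map hf (by fun_prop), gamM_lintegral _ (by fun_prop), epsM_lintegral _ hf,
    ← Complex.lintegral_comp_polarCoord_symm]
  have him : (fun r : ℝ => r^2) '' Set.Ioi 0 = Set.Ioi 0 := by
    ext y; constructor
    · rintro ⟨r, hr, rfl⟩; exact pow_pos (Set.mem_Ioi.1 hr) 2
    · intro hy; exact ⟨√y, Real.sqrt_pos.2 hy, Real.sq_sqrt (le_of_lt hy)⟩
  conv_rhs => rw [← him]
  rw [lintegral_image_eq_lintegral_abs_deriv_mul (f' := fun r => 2 * r) measurableSet_Ioi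
    (fun x _ => by simpa using (hasDerivAt_pow 2 x).hasDerivWithinAt)
    (fun a ha b hb hab => by
      exact (pow_left_inj₀ (le_of_lt ha) (le_of_lt hb) two_ne_zero).1 hab)]
  simp only [polarCoord_target, Complex.norm_polarCoord_symm, smul_eq_mul, sq_abs]
  rw [Measure.volume_eq_prod, ← Measure.prod_restrict, lintegral_prod _ (by fun_prop)]
  apply setLIntegral_congr_fun measurableSet_Ioi
  intro r hr
  simp only [lintegral_const, Measure.restrict_apply_univ, Real.volume_Ioo]
  rw [abs_of_pos (by have := Set.mem_Ioi.1 hr; positivity)]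
  have hr' : 0 ≤ r := le_of_lt hr
  rw [← mul_assoc, ← mul_assoc, ← ENNReal.ofReal_mul hr', mul_right_comm,
    ← ENNReal.ofReal_mul (by positivity), ← ENNReal.ofReal_mul (by positivity)]
  congr 2
  field_simp
  ring

lemma epsM_Ioi (c : ℝ) (hc : 0 ≤ c) : epsM (Set.Ioi c) = ENNReal.ofReal (Real.exp (-c)) := by
  rw [epsM, withDensity_apply _ measurableSet_Ioi, Measure.restrict_restrict measurableSet_Ioi,
    Set.inter_eq_left.2 (Set.Ioi_subset_Ioi hc), ← ofReal_integral_eq_lintegral_ofReal,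
    integral_exp_neg_Ioi]
  · have h := exp_neg_integrableOn_Ioi c one_pos
    simp only [neg_mul, one_mul] at h
    exact h
  · filter_upwards with x using (Real.exp_pos _).le

instance : IsProbabilityMeasure epsM := by
  constructor
  rw [epsM, withDensity_apply _ MeasurableSet.univ, Measure.restrict_univ]
  have := epsM_Ioi 0 le_rfl
  rw [epsM, withDensity_apply _ measurableSet_Ioi, Measure.restrict_restrict measurableSet_Ioi,
    Set.inter_self] at this
  simpa using this

instance : IsProbabilityMeasure gamM := by
  have : IsProbabilityMeasure (gamM.map (fun z => ‖z‖^2)) := by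
    rw [gamM_map]; infer_instance
  exact Measure.isProbabilityMeasure_of_map (fun z : ℂ => ‖z‖^2)

lemma epsM_pos : ∀ᵐ u ∂epsM, 0 < u := by
  rw [epsM]
  apply (withDensity_absolutelyContinuous _ _).ae_le
  exact ae_restrict_mem measurableSet_Ioi

lemma gamM_charFun (t : ℂ) : charFun gamM t = Complex.exp (-(‖t‖^2/4 : ℝ)) := by
  rw [charFun_apply, gamM, integral_withDensity_eq_integral_toReal_smul (by fun_prop)
    (by filter_upwards with z using ENNReal.ofReal_lt_top)]
  have h := GaussianFourier.integral_cexp_neg_mul_sq_norm_add (V := ℂ) (b := 1) (by simp) Complex.I t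
  have h2 : ∀ z : ℂ, (ENNReal.ofReal (Real.exp (-‖z‖^2) / Real.pi)).toReal •
      Complex.exp (inner ℝ z t * Complex.I) = (Real.pi : ℂ)⁻¹ *
        Complex.exp (-1 * ‖z‖^2 + Complex.I * inner ℝ t z) := by
    intro z
    rw [ENNReal.toReal_ofReal (by positivity), Complex.exp_add, real_inner_comm]
    simp [mul_comm]
    ring
  simp_rw [h2]
  rw [integral_const_mul, h]
  have : (Real.pi : ℂ) ≠ 0 := by exact_mod_cast Real.pi_ne_zero
  simp
  field_simp

lemma epsM_laplace (s : ℝ) (hs : 0 ≤ s) : ∫ u, Real.exp (-(s * u)) ∂epsM = (1 + s)⁻¹ := by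
  rw [epsM, integral_withDensity_eq_integral_toReal_smul (by fun_prop)
    (by filter_upwards with z using ENNReal.ofReal_lt_top)]
  have h2 : ∀ u : ℝ, (ENNReal.ofReal (Real.exp (-u))).toReal • Real.exp (-(s * u))
      = Real.exp (-(1+s) * u) := by
    intro u
    rw [ENNReal.toReal_ofReal (by positivity), smul_eq_mul, ← Real.exp_add]
    congr 1; ring
  simp_rw [h2]
  rw [integral_exp_mul_Ioi (by linarith)]
  have h1 : 1 + s ≠ 0 := by linarith
  have h3 : -(1 + s) ≠ 0 := neg_ne_zero.2 h1
  rw [mul_zero, Real.exp_zero]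
  field_simp

lemma epsM_step1 (a c : ℝ) (ha : 0 < a) :
    epsM {u | c < a * u} = ENNReal.ofReal (Real.exp (-(max 0 (c / a)))) := by
  rw [← epsM_Ioi _ (le_max_left _ _)]
  apply measure_congr
  filter_upwards [epsM_pos] with u hu
  apply propext
  change c < a * u ↔ max 0 (c/a) < u
  rw [max_lt_iff, div_lt_iff₀' ha]
  simp [hu]

lemma epsM_step2 (a b T : ℝ) (ha : b < a) (hb : 0 ≤ b) (hT : 0 ≤ T) :
    ∫⁻ u, ENNReal.ofReal (Real.exp (-(max 0 ((T - b * u) / a)))) ∂epsM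
      = ENNReal.ofReal ((a * Real.exp (-(T / a)) - b * Real.exp (-(T / b))) / (a - b)) := by
  have ha0 : 0 < a := lt_of_le_of_lt hb ha
  have hab : a - b ≠ 0 := by linarith
  rcases hb.eq_or_lt with rfl | hb0
  · have : 0 ≤ T / a := by positivity
    simp [max_eq_right this]
    congr 1
    field_simp
  rw [epsM_lintegral _ (by fun_prop)]
  have hTb : 0 ≤ T / b := by positivity
  rw [← Set.Ioc_union_Ioi_eq_Ioi hTb, lintegral_union measurableSet_Ioi
    (by rw [Set.disjoint_left]; intro u hu hu'; exact absurd hu.2 (not_le.2 hu'))]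
  have e1 : ∫⁻ u in Set.Ioi (T / b), ENNReal.ofReal (Real.exp (-u)) *
      ENNReal.ofReal (Real.exp (-(max 0 ((T - b * u) / a))))
      = ENNReal.ofReal (Real.exp (-(T / b))) := by
    rw [← epsM_Ioi _ hTb, epsM, withDensity_apply _ measurableSet_Ioi,
      Measure.restrict_restrict measurableSet_Ioi, Set.inter_eq_left.2 (Set.Ioi_subset_Ioi hTb)]
    apply setLIntegral_congr_fun measurableSet_Ioi
    intro u hu
    have h1 : T < b * u := (div_lt_iff₀' hb0).1 hu
    have : (T - b * u) / a ≤ 0 := div_nonpos_of_nonpos_of_nonneg (by linarith) ha0.le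
    simp [max_eq_left this]
  have e2 : ∫⁻ u in Set.Ioc 0 (T / b), ENNReal.ofReal (Real.exp (-u)) *
      ENNReal.ofReal (Real.exp (-(max 0 ((T - b * u) / a))))
      = ENNReal.ofReal (a / (a - b) * (Real.exp (-(T / a)) - Real.exp (-(T / b)))) := by
    have : ∫⁻ u in Set.Ioc 0 (T / b), ENNReal.ofReal (Real.exp (-u)) *
      ENNReal.ofReal (Real.exp (-(max 0 ((T - b * u) / a))))
      = ∫⁻ u in Set.Ioc 0 (T / b), ENNReal.ofReal (Real.exp (-(T / a) - (a - b) / a * u)) := by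
      apply setLIntegral_congr_fun measurableSet_Ioc
      intro u hu
      have h1 : b * u ≤ T := (le_div_iff₀' hb0).1 hu.2
      have : 0 ≤ (T - b * u) / a := div_nonneg (by linarith) ha0.le
      simp only [max_eq_right this]
      rw [← ENNReal.ofReal_mul (Real.exp_pos _).le, ← Real.exp_add]
      congr 2
      field_simp
      ring
    rw [this, ← ofReal_integral_eq_lintegral_ofReal]
    · congr 1
      rw [← intervalIntegral.integral_of_le hTb]
      rw [intervalIntegral.integral_eq_sub_of_hasDerivAt
        (f := fun u => -(a / (a - b)) * Real.exp (-(T / a) - (a - b) / a * u))]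
      · have : -(T / a) - (a - b) / a * (T / b) = -(T / b) := by field_simp; ring
        rw [this]; simp; ring
      · intro u _
        have h := ((((hasDerivAt_id u).const_mul ((a - b) / a)).const_sub (-(T / a))).exp).const_mul
          (-(a / (a - b)))
        have e : (-(a / (a - b)) * (Real.exp (-(T / a) - (a - b) / a * id u) * -((a - b) / a * 1)))
            = Real.exp (-(T / a) - (a - b) / a * u) := by
          simp only [id]
          field_simp
        rw [e] at h
        exact h
      · apply Continuous.intervalIntegrable; fun_prop
    · exact (Continuous.integrableOn_Ioc (by fun_prop))
    · filter_upwards with x using (Real.exp_pos _).le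
  rw [e1, e2, ← ENNReal.ofReal_add _ (Real.exp_pos _).le]
  · congr 1
    field_simp
    ring
  · apply mul_nonneg (div_nonneg ha0.le (by linarith))
    rw [sub_nonneg]
    apply Real.exp_le_exp.2
    rw [neg_le_neg_iff]
    exact div_le_div_of_nonneg_left hT hb0 ha.le

lemma epsM_pi (n : ℕ) (a b x : ℝ) (ha : b < a) (hb : 0 ≤ b) (hx : 0 ≤ x) :
    (Measure.pi (fun _ : Fin (n+2) => epsM)) {e | x * ∑ i : Fin n, e i.succ.succ < a * e 0 + b * e 1}
      = ENNReal.ofReal ((a * ((1 + x / a)⁻¹)^n - b * ((1 + x / b)⁻¹)^n) / (a - b)) := by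
  have ha0 : 0 < a := lt_of_le_of_lt hb ha
  have hab : 0 < a - b := by linarith
  have m1 := measurePreserving_piFinSuccAbove (fun _ : Fin (n+2) => epsM) 0
  have m2 := measurePreserving_piFinSuccAbove (fun _ : Fin (n+1) => epsM) 0
  have hs1 : MeasurableSet {p : ℝ × (Fin (n+1) → ℝ) | x * ∑ i : Fin n, p.2 i.succ < a * p.1 + b * p.2 0} :=
    measurableSet_lt (by fun_prop) (by fun_prop)
  have hpos : ∀ᵐ e ∂(Measure.pi (fun _ : Fin n => epsM)), ∀ i, 0 < e i := by
    rw [ae_all_iff]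
    intro i
    exact (measurePreserving_eval (fun _ : Fin n => epsM) i).quasiMeasurePreserving.ae epsM_pos
  have hint : ∀ s : ℝ, 0 ≤ s → Integrable (fun e : Fin n → ℝ => Real.exp (-(s * ∑ i, e i)))
      (Measure.pi (fun _ : Fin n => epsM)) := by
    intro s hs
    apply Integrable.of_bound (C := 1) (by fun_prop)
    filter_upwards [hpos] with e he
    rw [Real.norm_eq_abs, Real.abs_exp, Real.exp_le_one_iff, neg_nonpos]
    exact mul_nonneg hs (Finset.sum_nonneg fun i _ => (he i).le)
  have hval : ∀ s : ℝ, 0 ≤ s → ∫ e : Fin n → ℝ, Real.exp (-(s * ∑ i, e i))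
      ∂(Measure.pi (fun _ : Fin n => epsM)) = ((1 + s)⁻¹)^n := by
    intro s hs
    simp_rw [Finset.mul_sum, ← Finset.sum_neg_distrib, Real.exp_sum]
    rw [integral_fintype_prod_eq_pow (fun u => Real.exp (-(s * u))), epsM_laplace s hs]
    simp
  calc _ = (epsM.prod (Measure.pi fun _ : Fin (n+1) => epsM))
        {p : ℝ × (Fin (n+1) → ℝ) | x * ∑ i : Fin n, p.2 i.succ < a * p.1 + b * p.2 0} := by
        rw [← m1.measure_preimage hs1.nullMeasurableSet]
        rfl
    _ = ∫⁻ e : Fin (n+1) → ℝ, ENNReal.ofReal (Real.exp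
          (-(max 0 ((x * ∑ i : Fin n, e i.succ - b * e 0) / a))))
          ∂(Measure.pi fun _ : Fin (n+1) => epsM) := by
        rw [Measure.prod_apply_symm hs1]
        congr 1
        ext e
        rw [← epsM_step1 _ _ ha0]
        congr 1
        ext u
        simp [sub_lt_iff_lt_add]
    _ = ∫⁻ p : ℝ × (Fin n → ℝ), ENNReal.ofReal (Real.exp
          (-(max 0 ((x * ∑ i : Fin n, p.2 i - b * p.1) / a))))
          ∂(epsM.prod (Measure.pi fun _ : Fin n => epsM)) := by
        rw [← m2.lintegral_comp (by fun_prop)]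
        rfl
    _ = ∫⁻ e : Fin n → ℝ, ENNReal.ofReal ((a * Real.exp (-(x / a * ∑ i, e i))
          - b * Real.exp (-(x / b * ∑ i, e i))) / (a - b)) ∂(Measure.pi fun _ : Fin n => epsM) := by
        rw [lintegral_prod_symm _ (by fun_prop)]
        apply lintegral_congr_ae
        filter_upwards [hpos] with e he
        rw [epsM_step2 a b _ ha hb (mul_nonneg hx (Finset.sum_nonneg fun i _ => (he i).le))]
        simp only [div_mul_eq_mul_div]
    _ = _ := by
        have hxa : 0 ≤ x / a := by positivity
        have hxb : 0 ≤ x / b := by positivity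
        rw [← ofReal_integral_eq_lintegral_ofReal]
        · rw [integral_div, integral_sub ((hint _ hxa).const_mul _) ((hint _ hxb).const_mul _),
            integral_const_mul, integral_const_mul, hval _ hxa, hval _ hxb]
        · exact (((hint _ hxa).const_mul _).sub ((hint _ hxb).const_mul _)).div_const _
        · filter_upwards [hpos] with e he
          have hS : 0 ≤ ∑ i, e i := Finset.sum_nonneg fun i _ => (he i).le
          apply div_nonneg _ hab.le
          rw [sub_nonneg]
          rcases hb.eq_or_lt with rfl | hb0
          · simp; positivity
          apply mul_le_mul ha.le _ (Real.exp_pos _).le ha0.le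
          apply Real.exp_le_exp.2
          rw [neg_le_neg_iff]
          apply mul_le_mul_of_nonneg_right _ hS
          exact div_le_div_of_nonneg_left hx hb0 ha.le

noncomputable def gamN (n : ℕ) : Measure (EuclideanSpace ℂ (Fin (n+2))) :=
  (Measure.pi (fun _ : Fin (n+2) => gamM)).map (WithLp.toLp 2)

instance (n : ℕ) : IsProbabilityMeasure (gamN n) :=
  Measure.isProbabilityMeasure_map (by fun_prop)

lemma gamN_charFun (n : ℕ) (t : EuclideanSpace ℂ (Fin (n+2))) :
    charFun (gamN n) t = Complex.exp (-(‖t‖^2/4 : ℝ)) := by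
  rw [gamN, charFun_pi]
  simp_rw [gamM_charFun]
  rw [← Complex.exp_sum, EuclideanSpace.norm_sq_eq, Finset.sum_neg_distrib, Finset.sum_div]
  push_cast
  rfl

lemma gamN_inv (n : ℕ) (U : EuclideanSpace ℂ (Fin (n+2)) ≃ₗᵢ[ℂ] EuclideanSpace ℂ (Fin (n+2))) :
    (gamN n).map U = gamN n := by
  have : IsProbabilityMeasure ((gamN n).map U) := Measure.isProbabilityMeasure_map (by fun_prop)
  apply Measure.ext_of_charFun
  ext t
  obtain ⟨s, rfl⟩ := U.surjective t
  rw [aux_charFun_inv, gamN_charFun, gamN_charFun, U.norm_map]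

lemma gamN_map (n : ℕ) : (gamN n).map (fun w i => ‖w i‖^2) = Measure.pi (fun _ => epsM) := by
  rw [gamN, Measure.map_map (by fun_prop) (by fun_prop)]
  have : ∀ i : Fin (n+2), SigmaFinite (gamM.map (fun z => ‖z‖^2)) := by
    intro i; rw [gamM_map]; infer_instance
  have h := Measure.pi_map_pi (μ := fun _ : Fin (n+2) => gamM) (f := fun _ z => ‖z‖^2)
    (fun i => by fun_prop)
  simp only [gamM_map] at h
  exact h

lemma gamN_ne (n : ℕ) : ∀ᵐ w ∂(gamN n), w ≠ 0 := by
  have h : ∀ᵐ e ∂(Measure.pi (fun _ : Fin (n+2) => epsM)), 0 < e 0 :=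
    (measurePreserving_eval (fun _ : Fin (n+2) => epsM) 0).quasiMeasurePreserving.ae epsM_pos
  rw [← gamN_map] at h
  filter_upwards [ae_of_ae_map (by fun_prop) h] with w hw h0
  simp [h0] at hw

lemma main_aux (n : ℕ) (μ : Measure (EuclideanSpace ℂ (Fin (n+2)))) [IsProbabilityMeasure μ]
    (hsphere : ∀ᵐ v ∂μ, ‖v‖ = 1)
    (hinv : ∀ U : EuclideanSpace ℂ (Fin (n+2)) ≃ₗᵢ[ℂ] EuclideanSpace ℂ (Fin (n+2)),
      Measure.map (⇑U) μ = μ) (a b x : ℝ) (ha : b < a) (hb : 0 ≤ b) (hx : 0 ≤ x) :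
    μ {v | x * ∑ i : Fin n, ‖v i.succ.succ‖^2 < a * ‖v 0‖^2 + b * ‖v 1‖^2}
      = ENNReal.ofReal ((a * ((1 + x / a)⁻¹)^n - b * ((1 + x / b)⁻¹)^n) / (a - b)) := by
  have hm : Measurable (fun w : EuclideanSpace ℂ (Fin (n+2)) => (‖w‖⁻¹ : ℝ) • w) := by fun_prop
  have hB : MeasurableSet {v : EuclideanSpace ℂ (Fin (n+2)) |
      x * ∑ i : Fin n, ‖v i.succ.succ‖^2 < a * ‖v 0‖^2 + b * ‖v 1‖^2} :=
    measurableSet_lt (by fun_prop) (by fun_prop)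
  have hν : IsProbabilityMeasure ((gamN n).map (fun w => (‖w‖⁻¹ : ℝ) • w)) :=
    Measure.isProbabilityMeasure_map hm.aemeasurable
  have hμ : μ = (gamN n).map (fun w => (‖w‖⁻¹ : ℝ) • w) := by
    refine aux_unique μ _ hsphere ?_ hinv ?_
    · rw [ae_map_iff hm.aemeasurable (measurableSet_eq_fun (by fun_prop) (by fun_prop))]
      filter_upwards [gamN_ne n] with w hw
      rw [norm_smul, norm_inv, norm_norm, inv_mul_cancel₀ (norm_ne_zero_iff.2 hw)]
    · intro U
      rw [Measure.map_map (by fun_prop) hm]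
      conv_rhs => rw [← gamN_inv n U]
      rw [Measure.map_map hm (by fun_prop)]
      congr 1
      ext1 w
      simp only [Function.comp, U.norm_map]
      have : ∀ y : EuclideanSpace ℂ (Fin (n+2)), (‖w‖⁻¹ • y) = ((‖w‖⁻¹ : ℝ) : ℂ) • y := by
        intro y; ext i; simp
      rw [this, this, map_smul]
  rw [hμ, Measure.map_apply hm hB, ← epsM_pi n a b x ha hb hx, ← gamN_map,
    Measure.map_apply (by fun_prop) (measurableSet_lt (by fun_prop) (by fun_prop))]
  apply measure_congr
  filter_upwards [gamN_ne n] with w hw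
  apply propext
  change x * ∑ i : Fin n, ‖((‖w‖⁻¹ : ℝ) • w) i.succ.succ‖^2 < a * ‖((‖w‖⁻¹ : ℝ) • w) 0‖^2
    + b * ‖((‖w‖⁻¹ : ℝ) • w) 1‖^2 ↔ x * ∑ i : Fin n, ‖w i.succ.succ‖^2 < a * ‖w 0‖^2 + b * ‖w 1‖^2
  have hc : 0 < (‖w‖⁻¹)^2 := by have := norm_pos_iff.2 hw; positivity
  simp only [PiLp.smul_apply, norm_smul, norm_inv, norm_norm, mul_pow, ← Finset.mul_sum]
  rw [← mul_lt_mul_iff_right₀ hc (b := x * ∑ i : Fin n, ‖w i.succ.succ‖^2)]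
  ring_nf

/-- For `v` uniformly distributed on the unit sphere of `ℂ^{N_t}` (the unique
rotation-invariant probability measure), `N_t > 2`, `λ₁ > λ₂ > 0`, and `0 ≤ x ≤ λ₂`,
the cdf of `λ₁|v₁|² + λ₂|v₂|²` at `x` equals
`1 − (λ₁/(λ₁−λ₂))(1 − x/λ₁)^{N_t−1} + (λ₂/(λ₁−λ₂))(1 − x/λ₂)^{N_t−1}`. -/
theorem stmt0 (Nt : ℕ) (hNt : 2 < Nt) (lam1 lam2 : ℝ) (h21 : lam2 < lam1) (h2 : 0 < lam2)
    [MeasurableSpace (EuclideanSpace ℂ (Fin Nt))] [BorelSpace (EuclideanSpace ℂ (Fin Nt))]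
    (μ : Measure (EuclideanSpace ℂ (Fin Nt))) [IsProbabilityMeasure μ]
    (hsphere : ∀ᵐ v ∂μ, ‖v‖ = 1)
    (hinv : ∀ U : EuclideanSpace ℂ (Fin Nt) ≃ₗᵢ[ℂ] EuclideanSpace ℂ (Fin Nt),
      Measure.map (⇑U) μ = μ)
    (x : ℝ) (hx0 : 0 ≤ x) (hx : x ≤ lam2) :
    (μ {v | lam1 * ‖v ⟨0, by omega⟩‖ ^ 2 + lam2 * ‖v ⟨1, by omega⟩‖ ^ 2 ≤ x}).toReal
      = 1 - lam1 / (lam1 - lam2) * (1 - x / lam1) ^ (Nt - 1)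
        + lam2 / (lam1 - lam2) * (1 - x / lam2) ^ (Nt - 1) := by
  obtain ⟨n, rfl⟩ : ∃ n, Nt = n + 2 := ⟨Nt - 2, by omega⟩
  rename_i i1 i2 i3
  obtain rfl : i1 = WithLp.measurableSpace 2 (Fin (n+2) → ℂ) :=
    i2.measurable_eq.trans
      (aux_borel n).symm
  have h := main_aux n μ hsphere hinv (lam1 - x) (lam2 - x) x (by linarith) (by linarith) hx0
  have hB : MeasurableSet {v : EuclideanSpace ℂ (Fin (n+2)) |
      x * ∑ i : Fin n, ‖v i.succ.succ‖^2 < (lam1 - x) * ‖v 0‖^2 + (lam2 - x) * ‖v 1‖^2} :=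
    measurableSet_lt (by fun_prop) (by fun_prop)
  have h1 : μ {v | lam1 * ‖v ⟨0, by omega⟩‖ ^ 2 + lam2 * ‖v ⟨1, by omega⟩‖ ^ 2 ≤ x}
      = μ {v : EuclideanSpace ℂ (Fin (n+2)) |
      x * ∑ i : Fin n, ‖v i.succ.succ‖^2 < (lam1 - x) * ‖v 0‖^2 + (lam2 - x) * ‖v 1‖^2}ᶜ := by
    apply measure_congr
    filter_upwards [hsphere] with v hv
    apply propext
    change lam1 * ‖v 0‖ ^ 2 + lam2 * ‖v 1‖ ^ 2 ≤ x ↔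
      ¬ (x * ∑ i : Fin n, ‖v i.succ.succ‖^2 < (lam1 - x) * ‖v 0‖^2 + (lam2 - x) * ‖v 1‖^2)
    have hs : ‖v 0‖^2 + (‖v 1‖^2 + ∑ i : Fin n, ‖v i.succ.succ‖^2) = 1 := by
      have := EuclideanSpace.norm_sq_eq v
      rw [hv, Fin.sum_univ_succ, Fin.sum_univ_succ] at this
      rw [one_pow] at this
      exact this.symm
    have hs' : ∑ i : Fin n, ‖v i.succ.succ‖^2 = 1 - ‖v 0‖^2 - ‖v 1‖^2 := by linarith
    rw [not_lt, hs']
    constructor <;> intro h <;> linarith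
  have hl1 : 0 < lam1 := h2.trans h21
  have ha : 0 < lam1 - x := by linarith
  have hval : ((lam1 - x) * ((1 + x / (lam1 - x))⁻¹)^n - (lam2 - x) * ((1 + x / (lam2 - x))⁻¹)^n)
      / ((lam1 - x) - (lam2 - x)) = lam1 / (lam1 - lam2) * (1 - x / lam1) ^ (n + 1)
        - lam2 / (lam1 - lam2) * (1 - x / lam2) ^ (n + 1) := by
    have key : ∀ l : ℝ, 0 < l → x ≤ l →
        (l - x) * ((1 + x / (l - x))⁻¹)^n = l * (1 - x / l)^(n+1) := by
      intro l hl hxl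
      rcases hxl.eq_or_lt with rfl | hlt
      · simp [hl.ne']
      have h3 : l - x ≠ 0 := by linarith
      have h4 : (1 + x / (l - x))⁻¹ = 1 - x / l := by
        have : 1 + x / (l - x) = l / (l - x) := by field_simp; ring
        rw [this, inv_div]; field_simp
      rw [h4, pow_succ]
      field_simp
    rw [key _ hl1 (by linarith), key _ h2 hx]
    have : lam1 - x - (lam2 - x) = lam1 - lam2 := by ring
    rw [this]
    ring
  have hnn : 0 ≤ ((lam1 - x) * ((1 + x / (lam1 - x))⁻¹)^n
      - (lam2 - x) * ((1 + x / (lam2 - x))⁻¹)^n) / ((lam1 - x) - (lam2 - x)) := by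
    rw [hval, div_mul_eq_mul_div, div_mul_eq_mul_div, ← sub_div]
    have h5 : 0 ≤ 1 - x / lam2 := by rw [sub_nonneg, div_le_one h2]; exact hx
    have h6 : 1 - x / lam2 ≤ 1 - x / lam1 := by
      have := div_le_div_of_nonneg_left hx0 h2 h21.le
      linarith
    apply div_nonneg _ (by linarith)
    rw [sub_nonneg]
    exact mul_le_mul h21.le (pow_le_pow_left₀ h5 h6 _) (pow_nonneg h5 _) hl1.le
  rw [h1, prob_compl_eq_one_sub hB, h, ENNReal.toReal_sub_of_le _ ENNReal.one_ne_top,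
    ENNReal.toReal_ofReal hnn, hval]
  · simp only [ENNReal.toReal_one]
    rw [show n + 2 - 1 = n + 1 from rfl]
    ring
  · rw [← h]; exact prob_le_one
end

section
/- Let N_t > 2 be an integer and let λ₁ > λ₂ > 0 be real numbers. Let v = (v₁, …, v_{N_t}) be a random vector uniformly distributed on the unit sphere {v ∈ ℂ^{N_t} : ‖v‖ = 1}, and let F(x) = P(λ₁|v₁|² + λ₂|v₂|² ≤ x) be the cumulative distribution function of λ₁|v₁|² + λ₂|v₂|². Then for every x with 0 < x < λ₂, F is differentiable at x with derivative F′(x) = ((N_t−1)/(λ₁−λ₂))·[ (1 − x/λ₁)^{N_t−2} − (1 − x/λ₂)^{N_t−2} ]. -/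
open MeasureTheory

lemma beta_int (L : ℝ) (hL : 0 < L) (m : ℕ) : ∀ k : ℕ, ∫ t in (0:ℝ)..L, t ^ k * (1 - t / L) ^ m =
    L ^ (k+1) * (k.factorial * m.factorial / (k + m + 1).factorial) := by
  induction m with
  | zero =>
    intro k
    simp only [pow_zero, mul_one, integral_pow, Nat.factorial_zero, Nat.cast_one, add_zero, Nat.factorial_succ]
    push_cast
    have : (k.factorial : ℝ) ≠ 0 := by positivity
    field_simp
    simp
  | succ m ih =>
    intro k
    have hd : ∀ t ∈ Set.uIcc 0 L, HasDerivAt (fun t : ℝ => t ^ (k+1) * (1 - t / L) ^ (m+1))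
        ((k+1) * (t ^ k * (1 - t / L) ^ (m+1)) - (m+1) / L * (t ^ (k+1) * (1 - t / L) ^ m)) t := by
      intro t _
      have h1 := (hasDerivAt_id t).pow (k+1)
      have h2 := (((hasDerivAt_id t).div_const L).const_sub 1).pow (m+1)
      refine (h1.mul h2).congr_deriv ?_
      simp only [id, Nat.add_sub_cancel]
      push_cast
      simp only [Pi.pow_apply, id]
      ring
    have h := intervalIntegral.integral_eq_sub_of_hasDerivAt hd (Continuous.intervalIntegrable (by fun_prop) _ _)
    rw [intervalIntegral.integral_sub (Continuous.intervalIntegrable (by fun_prop) _ _) (Continuous.intervalIntegrable (by fun_prop) _ _),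
      intervalIntegral.integral_const_mul, intervalIntegral.integral_const_mul, ih (k+1), div_self hL.ne'] at h
    rw [show k + 1 + m + 1 = k + (m + 1) + 1 by ring, Nat.factorial_succ k] at h
    rw [Nat.factorial_succ m]
    have hf : ((k + (m+1) + 1).factorial : ℝ) ≠ 0 := by positivity
    have hk : (k:ℝ) + 1 ≠ 0 := by positivity
    apply mul_left_cancel₀ hk
    push_cast at h ⊢
    simp only [sub_self, ne_eq, Nat.add_eq_zero_iff, one_ne_zero, and_false, not_false_eq_true, zero_pow, mul_zero, zero_mul] at h
    rw [sub_eq_zero.mp h]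
    field_simp
    ring

lemma ext_moments (ρ₁ ρ₂ : Measure ℝ) [IsFiniteMeasure ρ₁] [IsFiniteMeasure ρ₂] (L : ℝ)
    (h1 : ∀ᵐ x ∂ρ₁, x ∈ Set.Icc 0 L) (h2 : ∀ᵐ x ∂ρ₂, x ∈ Set.Icc 0 L)
    (h : ∀ k : ℕ, ∫ x, x ^ k ∂ρ₁ = ∫ x, x ^ k ∂ρ₂) : ρ₁ = ρ₂ := by
  have hI : ∀ (ρ : Measure ℝ) [IsFiniteMeasure ρ], (∀ᵐ x ∂ρ, x ∈ Set.Icc 0 L) →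
      ∀ f : ℝ → ℝ, Continuous f → Integrable f ρ := by
    intro ρ _ hρ f hf
    obtain ⟨C, hC⟩ := (isCompact_Icc (a := (0:ℝ)) (b := L)).exists_bound_of_continuousOn hf.continuousOn
    refine Integrable.of_bound hf.aestronglyMeasurable C ?_
    filter_upwards [hρ] with v hv
    exact hC v hv
  have hp : ∀ p : Polynomial ℝ, ∫ x, p.eval x ∂ρ₁ = ∫ x, p.eval x ∂ρ₂ := by
    intro p
    simp only [Polynomial.eval_eq_sum_range]
    rw [integral_finsetSum _ (fun k _ => hI ρ₁ h1 _ (by fun_prop)),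
      integral_finsetSum _ (fun k _ => hI ρ₂ h2 _ (by fun_prop))]
    simp only [integral_const_mul, h]
  apply ext_of_forall_integral_eq_of_IsFiniteMeasure
  intro f
  have hb : ∀ ε > 0, |∫ x, f x ∂ρ₁ - ∫ x, f x ∂ρ₂| ≤ ε * (ρ₁.real Set.univ + ρ₂.real Set.univ) := by
    intro ε hε
    obtain ⟨p, hpε⟩ := exists_polynomial_near_of_continuousOn 0 L f f.continuous.continuousOn ε hε
    have key : ∀ (ρ : Measure ℝ) [IsFiniteMeasure ρ], (∀ᵐ x ∂ρ, x ∈ Set.Icc 0 L) →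
        |∫ x, p.eval x ∂ρ - ∫ x, f x ∂ρ| ≤ ε * ρ.real Set.univ := by
      intro ρ _ hρ
      rw [← integral_sub (hI ρ hρ _ p.continuous) (hI ρ hρ _ f.continuous)]
      rw [← Real.norm_eq_abs]
      apply norm_integral_le_of_norm_le_const
      filter_upwards [hρ] with x hx
      exact (hpε x hx).le
    have k1 := key ρ₁ h1
    have k2 := key ρ₂ h2
    rw [hp p] at k1
    rw [abs_le] at *
    constructor <;> linarith [k1.1, k1.2, k2.1, k2.2]
  have : |∫ x, f x ∂ρ₁ - ∫ x, f x ∂ρ₂| ≤ 0 := by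
    set M := ρ₁.real Set.univ + ρ₂.real Set.univ with hM
    have hM0 : 0 ≤ M := by positivity
    apply le_of_forall_pos_le_add
    intro ε hε
    have := hb (ε / (M + 1)) (by positivity)
    have h3 : ε / (M + 1) * M ≤ ε := by
      rw [div_mul_eq_mul_div, div_le_iff₀ (by positivity)]
      nlinarith
    linarith
  exact sub_eq_zero.mp (abs_nonpos_iff.mp this)

/-- the one-term density measure -/
noncomputable def nuM (K L : ℝ) (m : ℕ) : Measure ℝ :=
  (volume.restrict (Set.Ioc 0 L)).withDensity (fun t => ENNReal.ofReal (K * (1 - t / L) ^ m))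

lemma nuM_fin (K L : ℝ) (m : ℕ) : IsFiniteMeasure (nuM K L m) := by
  apply isFiniteMeasure_withDensity_ofReal
  have : Continuous (fun t : ℝ => K * (1 - t / L) ^ m) := by fun_prop
  exact (this.integrableOn_Ioc (a := 0) (b := L)).hasFiniteIntegral

lemma nuM_ae (K L : ℝ) (m : ℕ) : ∀ᵐ x ∂(nuM K L m), x ∈ Set.Icc 0 L := by
  apply (withDensity_absolutelyContinuous _ _).ae_le
  filter_upwards [ae_restrict_mem measurableSet_Ioc] with x hx
  exact Set.Ioc_subset_Icc_self hx

lemma nuM_moment (K L : ℝ) (hK : 0 ≤ K) (hL : 0 < L) (m k : ℕ) :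
    ∫ x, x ^ k ∂(nuM K L m) = K * (L ^ (k+1) * (k.factorial * m.factorial / (k + m + 1).factorial)) := by
  rw [nuM, integral_withDensity_eq_integral_toReal_smul (by fun_prop) (by simp), ← beta_int L hL,
    intervalIntegral.integral_of_le hL.le, ← integral_const_mul]
  apply setIntegral_congr_fun measurableSet_Ioc
  intro t ht
  have : 0 ≤ 1 - t / L := by rw [sub_nonneg, div_le_one hL]; exact ht.2
  simp only [smul_eq_mul]
  rw [ENNReal.toReal_ofReal (by positivity)]
  ring

lemma nuM_Iic (K L : ℝ) (hK : 0 ≤ K) (hL : 0 < L) (m : ℕ) (y : ℝ) (hy : 0 ≤ y) (hyL : y ≤ L) :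
    (nuM K L m (Set.Iic y)).toReal = ∫ t in (0:ℝ)..y, K * (1 - t / L) ^ m := by
  have hc : Continuous (fun t : ℝ => K * (1 - t / L) ^ m) := by fun_prop
  rw [nuM, withDensity_apply _ measurableSet_Iic, Measure.restrict_restrict measurableSet_Iic,
    show Set.Iic y ∩ Set.Ioc 0 L = Set.Ioc 0 y by
      ext t; simp only [Set.mem_inter_iff, Set.mem_Iic, Set.mem_Ioc]
      constructor
      · rintro ⟨h1, h2, h3⟩; exact ⟨h2, h1⟩
      · rintro ⟨h1, h2⟩; exact ⟨h2, h1, h2.trans hyL⟩,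
    ← ofReal_integral_eq_lintegral_ofReal hc.integrableOn_Ioc, intervalIntegral.integral_of_le hy]
  · apply ENNReal.toReal_ofReal
    apply setIntegral_nonneg measurableSet_Ioc
    intro t ht
    have : 0 ≤ 1 - t / L := by rw [sub_nonneg, div_le_one hL]; exact ht.2.trans hyL
    positivity
  · filter_upwards [ae_restrict_mem measurableSet_Ioc] with t ht
    have : 0 ≤ 1 - t / L := by rw [sub_nonneg, div_le_one hL]; exact ht.2.trans hyL
    change 0 ≤ K * (1 - t / L) ^ m
    positivity

section aux

set_option linter.unusedSectionVars false

variable {Nt : ℕ}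

lemma exists_unitary (i j : Fin Nt) (hij : i ≠ j) (α β γ δ : ℂ)
    (H : ∀ z w : ℂ, ‖α * z + β * w‖ ^ 2 + ‖γ * z + δ * w‖ ^ 2 = ‖z‖ ^ 2 + ‖w‖ ^ 2) :
    ∃ U : EuclideanSpace ℂ (Fin Nt) ≃ₗᵢ[ℂ] EuclideanSpace ℂ (Fin Nt),
      ∀ v, U v i = α * v i + β * v j ∧ U v j = γ * v i + δ * v j ∧
        ∀ k, k ≠ i → k ≠ j → U v k = v k := by
  let L : EuclideanSpace ℂ (Fin Nt) →ₗ[ℂ] EuclideanSpace ℂ (Fin Nt) :=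
    { toFun := fun v => WithLp.toLp 2 (fun k => if k = i then α * v i + β * v j
        else if k = j then γ * v i + δ * v j else v k)
      map_add' := by
        intro v w
        ext k
        simp only [PiLp.add_apply]
        split_ifs <;> ring
      map_smul' := by
        intro c v
        ext k
        simp only [PiLp.smul_apply, smul_eq_mul, RingHom.id_apply]
        split_ifs <;> ring }
  have hL : ∀ v k, L v k = if k = i then α * v i + β * v j
        else if k = j then γ * v i + δ * v j else v k := fun v k => rfl
  have hn : ∀ v, ‖L v‖ = ‖v‖ := by
    intro v
    rw [EuclideanSpace.norm_eq, EuclideanSpace.norm_eq]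
    congr 1
    have hj : j ∈ Finset.univ.erase i := by simp [hij.symm]
    rw [← Finset.add_sum_erase _ _ (Finset.mem_univ i), ← Finset.add_sum_erase _ _ hj,
      ← Finset.add_sum_erase _ (fun k => ‖v k‖ ^ 2) (Finset.mem_univ i),
      ← Finset.add_sum_erase _ (fun k => ‖v k‖ ^ 2) hj, ← add_assoc, ← add_assoc]
    congr 1
    · simp only [hL, if_neg hij.symm, if_true]
      exact H _ _
    · apply Finset.sum_congr rfl
      intro k hk
      simp only [Finset.mem_erase, Finset.mem_univ, and_true] at hk
      rw [hL, if_neg hk.2, if_neg hk.1]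
  refine ⟨LinearIsometry.toLinearIsometryEquiv ⟨L, hn⟩ rfl, fun v => ⟨?_, ?_, ?_⟩⟩
  · change L v i = _
    rw [hL, if_pos rfl]
  · change L v j = _
    rw [hL, if_neg hij.symm, if_pos rfl]
  · intro k h1 h2
    change L v k = _
    rw [hL, if_neg h1, if_neg h2]

variable [MeasurableSpace (EuclideanSpace ℂ (Fin Nt))] [BorelSpace (EuclideanSpace ℂ (Fin Nt))]
    {μ : Measure (EuclideanSpace ℂ (Fin Nt))} [IsProbabilityMeasure μ]

lemma integrable_of_cont (hsphere : ∀ᵐ v ∂μ, ‖v‖ = 1) {f : EuclideanSpace ℂ (Fin Nt) → ℝ}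
    (hf : Continuous f) : Integrable f μ := by
  obtain ⟨C, hC⟩ := (isCompact_closedBall (0 : EuclideanSpace ℂ (Fin Nt)) 1).exists_bound_of_continuousOn hf.continuousOn
  refine Integrable.of_bound hf.aestronglyMeasurable C ?_
  filter_upwards [hsphere] with v hv
  exact hC v (by simp [hv])

lemma integral_deriv_zero (hsphere : ∀ᵐ v ∂μ, ‖v‖ = 1)
    (G G' : ℝ → EuclideanSpace ℂ (Fin Nt) → ℝ)
    (hG : ∀ t, Continuous (G t)) (hG' : Continuous (Function.uncurry G'))
    (hd : ∀ t v, HasDerivAt (fun s => G s v) (G' t v) t)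
    (hc : ∀ t, ∫ v, G t v ∂μ = ∫ v, G 0 v ∂μ) : ∫ v, G' 0 v ∂μ = 0 := by
  obtain ⟨C, hC⟩ := ((isCompact_Icc (a := (-1:ℝ)) (b := 1)).prod (isCompact_closedBall (0 : EuclideanSpace ℂ (Fin Nt)) 1)).exists_bound_of_continuousOn hG'.continuousOn
  have := (hasDerivAt_integral_of_dominated_loc_of_deriv_le (μ := μ) (F := G) (F' := G') (x₀ := 0)
    (s := Set.Icc (-1:ℝ) 1) (bound := fun _ => C) (Icc_mem_nhds (by norm_num) (by norm_num))
    (Filter.Eventually.of_forall fun t => (hG t).aestronglyMeasurable)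
    (integrable_of_cont hsphere (hG 0))
    (hG'.comp (Continuous.prodMk_right 0)).aestronglyMeasurable ?_ (integrable_const C) 
    (Filter.Eventually.of_forall fun v t _ => hd t v)).2
  · have h2 : HasDerivAt (fun t => ∫ v, G t v ∂μ) 0 0 := by
      rw [funext hc]; exact hasDerivAt_const _ _
    exact this.unique h2
  · filter_upwards [hsphere] with v hv t ht
    exact hC (t, v) ⟨ht, by simp [hv]⟩

lemma integral_comp_U (hinv : ∀ U : EuclideanSpace ℂ (Fin Nt) ≃ₗᵢ[ℂ] EuclideanSpace ℂ (Fin Nt),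
      Measure.map (⇑U) μ = μ) (U : EuclideanSpace ℂ (Fin Nt) ≃ₗᵢ[ℂ] EuclideanSpace ℂ (Fin Nt))
    {f : EuclideanSpace ℂ (Fin Nt) → ℝ} (hf : Continuous f) :
    ∫ v, f (U v) ∂μ = ∫ v, f v ∂μ := by
  conv_rhs => rw [← hinv U]
  rw [integral_map U.continuous.measurable.aemeasurable hf.aestronglyMeasurable]

lemma cross_sq (hsphere : ∀ᵐ v ∂μ, ‖v‖ = 1)
    (hinv : ∀ U : EuclideanSpace ℂ (Fin Nt) ≃ₗᵢ[ℂ] EuclideanSpace ℂ (Fin Nt),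
      Measure.map (⇑U) μ = μ) (i j : Fin Nt) (hij : i ≠ j)
    (q : EuclideanSpace ℂ (Fin Nt) → ℝ) (hqc : Continuous q)
    (hq : ∀ v w, (∀ k, k ≠ i → k ≠ j → v k = w k) → q v = q w) (m n : ℕ) :
    2 * ∫ v, (‖v i‖^2)^m * (‖v j‖^2)^n * ((v i).re * (v j).re + (v i).im * (v j).im)^2 * q v ∂μ
     = ∫ v, (‖v i‖^2)^(m+1) * (‖v j‖^2)^(n+1) * q v ∂μ := by
  obtain ⟨U, hU⟩ := exists_unitary i j hij Complex.I 0 0 1 (by intro z w; simp)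
  have h1 := integral_comp_U hinv U (f := fun v => (‖v i‖^2)^m * (‖v j‖^2)^n * ((v i).re * (v j).re + (v i).im * (v j).im)^2 * q v) (by fun_prop)
  have hqU : ∀ v, q (U v) = q v := fun v => hq _ _ (hU v).2.2
  simp only [hqU, (hU _).1, (hU _).2.1] at h1
  rw [two_mul]
  nth_rw 1 [← h1]
  rw [← integral_add (integrable_of_cont hsphere (by fun_prop)) (integrable_of_cont hsphere (by fun_prop))]
  congr 1
  ext v
  simp only [zero_mul, add_zero, one_mul, zero_add, norm_mul, Complex.norm_I, Complex.mul_re, Complex.mul_im, Complex.I_re, Complex.I_im]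
  simp only [Complex.sq_norm, Complex.normSq_apply]
  ring

lemma relation (hsphere : ∀ᵐ v ∂μ, ‖v‖ = 1)
    (hinv : ∀ U : EuclideanSpace ℂ (Fin Nt) ≃ₗᵢ[ℂ] EuclideanSpace ℂ (Fin Nt),
      Measure.map (⇑U) μ = μ) (i j : Fin Nt) (hij : i ≠ j)
    (q : EuclideanSpace ℂ (Fin Nt) → ℝ) (hqc : Continuous q)
    (hq : ∀ v w, (∀ k, k ≠ i → k ≠ j → v k = w k) → q v = q w) (a b : ℕ) :
    (a + 1) * ∫ v, (‖v i‖^2)^a * (‖v j‖^2)^(b+1) * q v ∂μ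
     = (b + 1) * ∫ v, (‖v i‖^2)^(a+1) * (‖v j‖^2)^b * q v ∂μ := by
  let C : EuclideanSpace ℂ (Fin Nt) → ℝ := fun v => (v i).re * (v j).re + (v i).im * (v j).im
  have hCc : Continuous C := by fun_prop
  let Xt : ℝ → EuclideanSpace ℂ (Fin Nt) → ℝ := fun t v =>
    Real.cos t ^ 2 * ‖v i‖^2 + 2 * Real.cos t * Real.sin t * C v + Real.sin t ^ 2 * ‖v j‖^2
  let Yt : ℝ → EuclideanSpace ℂ (Fin Nt) → ℝ := fun t v =>
    Real.sin t ^ 2 * ‖v i‖^2 - 2 * Real.cos t * Real.sin t * C v + Real.cos t ^ 2 * ‖v j‖^2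
  let Ct : ℝ → EuclideanSpace ℂ (Fin Nt) → ℝ := fun t v =>
    (Real.cos t ^ 2 - Real.sin t ^ 2) * C v + Real.cos t * Real.sin t * (‖v j‖^2 - ‖v i‖^2)
  have dX : ∀ t v, HasDerivAt (fun s => Xt s v) (2 * Ct t v) t := by
    intro t v
    have hc := Real.hasDerivAt_cos t
    have hs := Real.hasDerivAt_sin t
    refine ((((hc.pow 2).mul_const (‖v i‖^2)).add (((hc.const_mul 2).mul hs).mul_const (C v))).add
      ((hs.pow 2).mul_const (‖v j‖^2))).congr_deriv ?_
    simp only [Ct]; push_cast; ring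
  have dY : ∀ t v, HasDerivAt (fun s => Yt s v) (-2 * Ct t v) t := by
    intro t v
    have hc := Real.hasDerivAt_cos t
    have hs := Real.hasDerivAt_sin t
    refine ((((hs.pow 2).mul_const (‖v i‖^2)).sub (((hc.const_mul 2).mul hs).mul_const (C v))).add
      ((hc.pow 2).mul_const (‖v j‖^2))).congr_deriv ?_
    simp only [Ct]; push_cast; ring
  have dC : ∀ t v, HasDerivAt (fun s => Ct s v) (Yt t v - Xt t v) t := by
    intro t v
    have hc := Real.hasDerivAt_cos t
    have hs := Real.hasDerivAt_sin t
    refine ((((hc.pow 2).sub (hs.pow 2)).mul_const (C v)).add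
      ((hc.mul hs).mul_const (‖v j‖^2 - ‖v i‖^2))).congr_deriv ?_
    simp only [Xt, Yt]; push_cast; ring
  have key := integral_deriv_zero (μ := μ) hsphere
    (fun t v => Xt t v ^ a * Yt t v ^ b * Ct t v * q v)
    (fun t v => (((a * Xt t v ^ (a-1) * (2 * Ct t v)) * Yt t v ^ b
      + Xt t v ^ a * (b * Yt t v ^ (b-1) * (-2 * Ct t v))) * Ct t v
      + Xt t v ^ a * Yt t v ^ b * (Yt t v - Xt t v)) * q v)
    (by intro t; fun_prop) (by simp only [Function.uncurry_def]; fun_prop)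
    (by
      intro t v
      exact (((((dX t v).pow a).mul ((dY t v).pow b)).mul (dC t v)).mul_const (q v)))
    (by
      intro t
      obtain ⟨U, hU⟩ := exists_unitary i j hij (Real.cos t) (Real.sin t) (-Real.sin t) (Real.cos t) (by
        intro z w
        rw [← Complex.ofReal_neg]
        simp only [Complex.sq_norm, Complex.normSq_apply, Complex.add_re, Complex.add_im, Complex.re_ofReal_mul, Complex.im_ofReal_mul]
        linear_combination (z.re^2+z.im^2+w.re^2+w.im^2) * Real.sin_sq_add_cos_sq t)
      have h1 := integral_comp_U hinv U (f := fun v => Xt 0 v ^ a * Yt 0 v ^ b * Ct 0 v * q v) (by fun_prop)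
      rw [← h1]
      congr 1
      ext v
      have e1 : Xt 0 (U v) = Xt t v := by
        simp only [Xt, C, (hU v).1]
        simp only [Real.cos_zero, Real.sin_zero, Complex.sq_norm, Complex.normSq_apply, Complex.add_re, Complex.add_im, Complex.re_ofReal_mul, Complex.im_ofReal_mul]
        ring
      have e2 : Yt 0 (U v) = Yt t v := by
        simp only [Yt, C, (hU v).2.1]
        rw [← Complex.ofReal_neg] 
        simp only [Real.cos_zero, Real.sin_zero, Complex.sq_norm, Complex.normSq_apply, Complex.add_re, Complex.add_im, Complex.re_ofReal_mul, Complex.im_ofReal_mul]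
        ring
      have e3 : Ct 0 (U v) = Ct t v := by
        simp only [Ct, C, (hU v).1, (hU v).2.1]
        rw [← Complex.ofReal_neg] 
        simp only [Real.cos_zero, Real.sin_zero, Complex.sq_norm, Complex.normSq_apply, Complex.add_re, Complex.add_im, Complex.re_ofReal_mul, Complex.im_ofReal_mul]
        ring
      have e4 : q (U v) = q v := hq _ _ (hU v).2.2
      rw [e1, e2, e3, e4])
  have x0 : ∀ v, Xt 0 v = ‖v i‖^2 := by intro v; simp [Xt]
  have y0 : ∀ v, Yt 0 v = ‖v j‖^2 := by intro v; simp [Yt]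
  have c0 : ∀ v, Ct 0 v = C v := by intro v; simp [Ct]
  simp only [x0, y0, c0] at key
  have I1 : ∀ m n : ℕ, Integrable (fun v => (‖v i‖^2)^m * (‖v j‖^2)^n * q v) μ := fun m n =>
    integrable_of_cont hsphere (by fun_prop)
  have I2 : ∀ m n : ℕ, Integrable (fun v => (‖v i‖^2)^m * (‖v j‖^2)^n * C v ^ 2 * q v) μ := fun m n =>
    integrable_of_cont hsphere (by fun_prop)
  have cs := cross_sq hsphere hinv i j hij q hqc hq
  have key2 : (2 * a) * ∫ v, (‖v i‖^2)^(a-1) * (‖v j‖^2)^b * C v ^ 2 * q v ∂μ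
      - (2 * b) * (∫ v, (‖v i‖^2)^a * (‖v j‖^2)^(b-1) * C v ^ 2 * q v ∂μ)
      + ((∫ v, (‖v i‖^2)^a * (‖v j‖^2)^(b+1) * q v ∂μ)
      - ∫ v, (‖v i‖^2)^(a+1) * (‖v j‖^2)^b * q v ∂μ) = 0 := by
    rw [← key, ← integral_const_mul, ← integral_const_mul, ← integral_sub ((I2 _ _).const_mul _) ((I2 _ _).const_mul _),
      ← integral_sub (I1 _ _) (I1 _ _), ← integral_add (integrable_of_cont hsphere (by fun_prop)) (integrable_of_cont hsphere (by fun_prop))]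
    congr 1
    ext v
    ring
  have ha : (2 * a) * ∫ v, (‖v i‖^2)^(a-1) * (‖v j‖^2)^b * C v ^ 2 * q v ∂μ =
      a * ∫ v, (‖v i‖^2)^a * (‖v j‖^2)^(b+1) * q v ∂μ := by
    rcases a with _ | a
    · simp
    · rw [← cs a b]; simp only [C, Nat.add_sub_cancel]; ring
  have hb : (2 * b) * ∫ v, (‖v i‖^2)^a * (‖v j‖^2)^(b-1) * C v ^ 2 * q v ∂μ =
      b * ∫ v, (‖v i‖^2)^(a+1) * (‖v j‖^2)^b * q v ∂μ := by
    rcases b with _ | b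
    · simp
    · rw [← cs a b]; simp only [C, Nat.add_sub_cancel]; ring
  rw [ha, hb] at key2
  linear_combination key2

lemma moment_step (hsphere : ∀ᵐ v ∂μ, ‖v‖ = 1)
    (hinv : ∀ U : EuclideanSpace ℂ (Fin Nt) ≃ₗᵢ[ℂ] EuclideanSpace ℂ (Fin Nt),
      Measure.map (⇑U) μ = μ) (i j : Fin Nt) (hij : i ≠ j) (a b : ℕ) :
    ((a : ℝ) + b + Nt) * ∫ v, (‖v i‖^2)^(a+1) * (‖v j‖^2)^b ∂μ
     = (a + 1) * ∫ v, (‖v i‖^2)^a * (‖v j‖^2)^b ∂μ := by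
  have hsum : ∫ v, (‖v i‖^2)^a * (‖v j‖^2)^b ∂μ
      = ∑ k, ∫ v, (‖v i‖^2)^a * (‖v j‖^2)^b * ‖v k‖^2 ∂μ := by
    rw [← integral_finsetSum _ (fun k _ => integrable_of_cont hsphere (by fun_prop))]
    apply integral_congr_ae
    filter_upwards [hsphere] with v hv
    rw [← Finset.mul_sum, ← EuclideanSpace.norm_sq_eq, hv]
    simp
  have hk : ∀ k, k ≠ i → k ≠ j → (a + 1) * ∫ v, (‖v i‖^2)^a * (‖v j‖^2)^b * ‖v k‖^2 ∂μ
      = ∫ v, (‖v i‖^2)^(a+1) * (‖v j‖^2)^b ∂μ := by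
    intro k hki hkj
    have := relation hsphere hinv i k hki.symm (fun v => (‖v j‖^2)^b) (by fun_prop)
      (by intro v w h; simp only [h j hij.symm hkj.symm]) a 0
    simp only [Nat.cast_zero, zero_add, one_mul, pow_one, pow_zero, mul_one] at this
    rw [← this]
    congr 2
    ext v
    ring
  have hj : (a + 1) * ∫ v, (‖v i‖^2)^a * (‖v j‖^2)^b * ‖v j‖^2 ∂μ
      = (b + 1) * ∫ v, (‖v i‖^2)^(a+1) * (‖v j‖^2)^b ∂μ := by
    have := relation hsphere hinv i j hij (fun v => 1) (by fun_prop)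
      (by intro v w h; rfl) a b
    simp only [mul_one] at this
    rw [← this]
    congr 2
    ext v
    ring
  have hi : ∫ v, (‖v i‖^2)^a * (‖v j‖^2)^b * ‖v i‖^2 ∂μ
      = ∫ v, (‖v i‖^2)^(a+1) * (‖v j‖^2)^b ∂μ := by
    congr 1
    ext v
    ring
  have hjm : j ∈ Finset.univ.erase i := by simp [hij.symm]
  have hcard : (((Finset.univ.erase i).erase j).card : ℝ) = (Nt : ℝ) - 2 := by
    have h1 := Finset.card_erase_add_one hjm
    have h2 := Finset.card_erase_add_one (Finset.mem_univ i)
    rw [Finset.card_univ, Fintype.card_fin] at h2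
    have h3 : ((Finset.univ.erase i).erase j).card + 2 = Nt := by omega
    have h4 : (((Finset.univ.erase i).erase j).card : ℝ) + 2 = Nt := by exact_mod_cast h3
    linarith
  rw [hsum, Finset.mul_sum, ← Finset.add_sum_erase _ _ (Finset.mem_univ i),
    ← Finset.add_sum_erase _ _ hjm, hj, hi]
  rw [Finset.sum_congr rfl (g := fun _ => ∫ v, (‖v i‖^2)^(a+1) * (‖v j‖^2)^b ∂μ)
    (fun k hk' => by
      simp only [Finset.mem_erase, Finset.mem_univ, and_true] at hk'
      exact hk k hk'.2 hk'.1), Finset.sum_const, nsmul_eq_mul, hcard]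
  ring

lemma moment (hsphere : ∀ᵐ v ∂μ, ‖v‖ = 1)
    (hinv : ∀ U : EuclideanSpace ℂ (Fin Nt) ≃ₗᵢ[ℂ] EuclideanSpace ℂ (Fin Nt),
      Measure.map (⇑U) μ = μ) (n : ℕ) (hn : Nt = n + 1) (i j : Fin Nt) (hij : i ≠ j) (a b : ℕ) :
    ((a + b + n).factorial : ℝ) * ∫ v, (‖v i‖^2)^a * (‖v j‖^2)^b ∂μ
     = a.factorial * b.factorial * n.factorial := by
  have hN : (Nt : ℝ) = n + 1 := by rw [hn]; push_cast; ring
  induction a with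
  | succ a ih =>
    have h := moment_step hsphere hinv i j hij a b
    rw [show a + 1 + b + n = (a + b + n) + 1 by ring, Nat.factorial_succ, Nat.factorial_succ]
    push_cast
    rw [hN] at h
    linear_combination ((a + b + n).factorial : ℝ) * h + (a + 1) * ih
  | zero =>
    induction b with
    | zero => simp
    | succ b ih =>
      have h := moment_step hsphere hinv j i hij.symm b 0
      simp only [pow_zero, one_mul, mul_one, Nat.cast_zero, zero_add, add_zero, Nat.factorial_zero, Nat.cast_one] at h ih ⊢
      rw [show b + 1 + n = (b + n) + 1 by ring, Nat.factorial_succ, Nat.factorial_succ]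
      push_cast
      rw [hN] at h
      linear_combination ((b + n).factorial : ℝ) * h + (b + 1) * ih

lemma moment_Z (hsphere : ∀ᵐ v ∂μ, ‖v‖ = 1)
    (hinv : ∀ U : EuclideanSpace ℂ (Fin Nt) ≃ₗᵢ[ℂ] EuclideanSpace ℂ (Fin Nt),
      Measure.map (⇑U) μ = μ) (n : ℕ) (hn : Nt = n + 1) (i j : Fin Nt) (hij : i ≠ j)
    (x y : ℝ) (k : ℕ) :
    (x - y) * ∫ v, (x * ‖v i‖^2 + y * ‖v j‖^2)^k ∂μ
     = k.factorial * n.factorial / (k + n).factorial * (x ^ (k+1) - y ^ (k+1)) := by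
  simp only [add_pow]
  rw [integral_finsetSum _ (fun k _ => integrable_of_cont hsphere (by fun_prop)),
    ← geom_sum₂_mul, mul_comm (x - y), ← mul_assoc, Finset.mul_sum]
  congr 1
  apply Finset.sum_congr rfl
  intro m hm
  have hmk : m ≤ k := Nat.lt_succ_iff.mp (Finset.mem_range.mp hm)
  have h := moment hsphere hinv n hn i j hij m (k - m)
  rw [show m + (k - m) + n = k + n by omega] at h
  have hc := Nat.choose_mul_factorial_mul_factorial hmk
  have hc' : (k.choose m : ℝ) * m.factorial * (k-m).factorial = k.factorial := by exact_mod_cast hc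
  have e : ∀ v : EuclideanSpace ℂ (Fin Nt), (x * ‖v i‖^2)^m * (y * ‖v j‖^2)^(k-m) * (k.choose m : ℝ)
      = (x ^ m * y ^ (k-m) * k.choose m) * ((‖v i‖^2)^m * (‖v j‖^2)^(k-m)) := by
    intro v; rw [mul_pow, mul_pow]; ring
  simp only [e]
  rw [integral_const_mul, show k + 1 - 1 - m = k - m by omega]
  have hf : ((k + n).factorial : ℝ) ≠ 0 := by positivity
  rw [← hc']
  field_simp
  linear_combination (x^m * y^(k-m) * k.choose m) * h

end aux

/-- Let `F` be the cdf of `λ₁|v₁|² + λ₂|v₂|²` for `v` uniformly distributed on the unit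
sphere of `ℂ^{N_t}` (the unique rotation-invariant probability measure), with `N_t > 2`
and `λ₁ > λ₂ > 0`.  For `0 < x < λ₂`, `F` is differentiable at `x` with derivative
`((N_t−1)/(λ₁−λ₂))·[(1 − x/λ₁)^{N_t−2} − (1 − x/λ₂)^{N_t−2}]`. -/
theorem stmt2 (Nt : ℕ) (hNt : 2 < Nt) (lam1 lam2 : ℝ) (h21 : lam2 < lam1) (h2 : 0 < lam2)
    [MeasurableSpace (EuclideanSpace ℂ (Fin Nt))] [BorelSpace (EuclideanSpace ℂ (Fin Nt))]
    (μ : Measure (EuclideanSpace ℂ (Fin Nt))) [IsProbabilityMeasure μ]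
    (hsphere : ∀ᵐ v ∂μ, ‖v‖ = 1)
    (hinv : ∀ U : EuclideanSpace ℂ (Fin Nt) ≃ₗᵢ[ℂ] EuclideanSpace ℂ (Fin Nt),
      Measure.map (⇑U) μ = μ)
    (F : ℝ → ℝ)
    (hF : ∀ y : ℝ,
      F y = (μ {v | lam1 * ‖v ⟨0, by omega⟩‖ ^ 2 + lam2 * ‖v ⟨1, by omega⟩‖ ^ 2 ≤ y}).toReal)
    (x : ℝ) (hx0 : 0 < x) (hx : x < lam2) :
    HasDerivAt F
      (((Nt : ℝ) - 1) / (lam1 - lam2)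
        * ((1 - x / lam1) ^ (Nt - 2) - (1 - x / lam2) ^ (Nt - 2))) x := by
  obtain ⟨m, rfl⟩ : ∃ m, Nt = m + 2 := ⟨Nt - 2, by omega⟩
  have h1 : 0 < lam1 := h2.trans h21
  have hd : 0 < lam1 - lam2 := sub_pos.mpr h21
  set i : Fin (m + 2) := ⟨0, by omega⟩ with hi
  set j : Fin (m + 2) := ⟨1, by omega⟩ with hj
  have hij : i ≠ j := by simp [hi, hj]
  set K : ℝ := ((m : ℝ) + 1) / (lam1 - lam2) with hK
  have hK0 : 0 ≤ K := by positivity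
  let Z : EuclideanSpace ℂ (Fin (m + 2)) → ℝ := fun v => lam1 * ‖v i‖ ^ 2 + lam2 * ‖v j‖ ^ 2
  have hZ : Continuous Z := by fun_prop
  have := nuM_fin K lam1 m
  have := nuM_fin K lam2 m
  have : IsFiniteMeasure (Measure.map Z μ) := by infer_instance
  have aeZ : ∀ᵐ x ∂(Measure.map Z μ), x ∈ Set.Icc 0 lam1 := by
    refine (ae_map_iff (p := fun x => x ∈ Set.Icc 0 lam1) hZ.measurable.aemeasurable measurableSet_Icc).mpr ?_
    filter_upwards [hsphere] with v hv
    have hs : ‖v i‖ ^ 2 + ‖v j‖ ^ 2 ≤ 1 := by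
      have h3 : ‖v‖ ^ 2 = 1 := by rw [hv]; norm_num
      rw [EuclideanSpace.norm_sq_eq] at h3
      rw [← h3, ← Finset.sum_pair (f := fun k => ‖v k‖ ^ 2) hij]
      exact Finset.sum_le_sum_of_subset_of_nonneg (Finset.subset_univ _) (fun _ _ _ => by positivity)
    refine ⟨by positivity, ?_⟩
    simp only [Z]
    nlinarith [sq_nonneg ‖v i‖, sq_nonneg ‖v j‖]
  have meq : Measure.map Z μ + nuM K lam2 m = nuM K lam1 m := by
    apply ext_moments _ _ lam1
    · rw [ae_add_measure_iff]
      refine ⟨aeZ, ?_⟩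
      filter_upwards [nuM_ae K lam2 m] with x hx
      exact ⟨hx.1, hx.2.trans h21.le⟩
    · exact nuM_ae K lam1 m
    · intro k
      have hint : ∀ (ρ : Measure ℝ) [IsFiniteMeasure ρ], (∀ᵐ x ∂ρ, x ∈ Set.Icc 0 lam1) →
          Integrable (fun x : ℝ => x ^ k) ρ := by
        intro ρ _ hρ
        refine Integrable.of_bound (by fun_prop) (lam1 ^ k) ?_
        filter_upwards [hρ] with x hx
        rw [norm_pow, Real.norm_of_nonneg hx.1]
        exact pow_le_pow_left₀ hx.1 hx.2 k
      rw [integral_add_measure (hint _ aeZ) (hint _ (by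
        filter_upwards [nuM_ae K lam2 m] with x hx
        exact ⟨hx.1, hx.2.trans h21.le⟩)), nuM_moment K lam1 hK0 h1, nuM_moment K lam2 hK0 h2,
        integral_map hZ.measurable.aemeasurable (by fun_prop)]
      have hm := moment_Z hsphere hinv (m + 1) rfl i j hij lam1 lam2 k
      rw [← add_assoc, Nat.factorial_succ m] at hm
      push_cast at hm
      have hm2 : ∫ v, Z v ^ k ∂μ = k.factorial * ((m + 1) * m.factorial) / (k + m + 1).factorial * (lam1 ^ (k+1) - lam2 ^ (k+1)) / (lam1 - lam2) := by
        rw [eq_div_iff hd.ne', mul_comm]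
        exact hm
      rw [hm2, hK]
      ring
  have hFy : ∀ y ∈ Set.Ioo 0 lam2, F y = (∫ t in (0:ℝ)..y, K * (1 - t / lam1) ^ m)
      - ∫ t in (0:ℝ)..y, K * (1 - t / lam2) ^ m := by
    intro y hy
    rw [← nuM_Iic K lam1 hK0 h1 m y hy.1.le (hy.2.trans h21).le,
      ← nuM_Iic K lam2 hK0 h2 m y hy.1.le hy.2.le, ← meq, Measure.add_apply,
      ENNReal.toReal_add (measure_ne_top _ _) (measure_ne_top _ _), add_sub_cancel_right,
      Measure.map_apply hZ.measurable measurableSet_Iic, hF y]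
    rfl
  have hder : ∀ L : ℝ, HasDerivAt (fun y => ∫ t in (0:ℝ)..y, K * (1 - t / L) ^ m) (K * (1 - x / L) ^ m) x := by
    intro L
    have hc : Continuous (fun t : ℝ => K * (1 - t / L) ^ m) := by fun_prop
    exact (hc.integral_hasStrictDerivAt 0 x).hasDerivAt
  have hfin := (hder lam1).sub (hder lam2)
  refine (hfin.congr_of_eventuallyEq ?_).congr_deriv ?_
  · filter_upwards [Ioo_mem_nhds hx0 hx] with y hy
    exact hFy y hy
  · rw [hK]
    simp only [Nat.add_sub_cancel]
    push_cast
    ring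
end

section
/- Define φ(m, n) = ∫₀^∞ λ₁^m e^{−λ₁} ( ∫₀^{λ₁} λ₂^n e^{−λ₂} dλ₂ ) dλ₁ for nonnegative integers m, n. Then for all integers m ≥ 1 and n ≥ 1, φ(m, n) = m·n·φ(m−1, n−1) − (m − n)·(m + n − 1)! / 2^{m+n+1}. -/
open MeasureTheory

/-- The iterated integral `φ(m, n) = ∫₀^∞ λ₁^m e^{−λ₁} (∫₀^{λ₁} λ₂^n e^{−λ₂} dλ₂) dλ₁`. -/
noncomputable def phi (m n : ℕ) : ℝ :=
  ∫ l1 in Set.Ioi (0 : ℝ), l1 ^ m * Real.exp (-l1) * ∫ l2 in (0:ℝ)..l1, l2 ^ n * Real.exp (-l2)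

/-- inner integral -/
noncomputable def innerG (n : ℕ) (x : ℝ) : ℝ := ∫ t in (0:ℝ)..x, t ^ n * Real.exp (-t)

lemma innerG_deriv (n : ℕ) (x : ℝ) : HasDerivAt (innerG n) (x ^ n * Real.exp (-x)) x := by
  have hc : Continuous (fun t : ℝ => t ^ n * Real.exp (-t)) := by fun_prop
  exact intervalIntegral.integral_hasDerivAt_right (hc.intervalIntegrable _ _)
    hc.stronglyMeasurable.stronglyMeasurableAtFilter hc.continuousAt

lemma innerG_cont (n : ℕ) : Continuous (innerG n) :=
  continuous_iff_continuousAt.2 fun x => (innerG_deriv n x).continuousAt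

lemma exp_neg_deriv (x : ℝ) : HasDerivAt (fun t : ℝ => Real.exp (-t)) (-Real.exp (-x)) x := by
  simpa using (hasDerivAt_neg x).exp

lemma innerG_zero (x : ℝ) : innerG 0 x = 1 - Real.exp (-x) := by
  have h := intervalIntegral.integral_eq_sub_of_hasDerivAt (a := 0) (b := x)
    (f := fun t => -Real.exp (-t)) (f' := fun t => t ^ 0 * Real.exp (-t))
    (fun t _ => by simpa using (exp_neg_deriv t).fun_neg)
    (Continuous.intervalIntegrable (by fun_prop) _ _)
  unfold innerG
  rw [h]; simp; ring

lemma innerG_succ (n : ℕ) (x : ℝ) :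
    innerG (n + 1) x = (n + 1) * innerG n x - x ^ (n + 1) * Real.exp (-x) := by
  have h := intervalIntegral.integral_eq_sub_of_hasDerivAt (a := 0) (b := x)
    (f := fun t => (n + 1) * innerG n t - t ^ (n + 1) * Real.exp (-t))
    (f' := fun t => t ^ (n + 1) * Real.exp (-t))
    (fun t _ => by
      have h1 := ((innerG_deriv n t).const_mul ((n : ℝ) + 1)).sub
        ((hasDerivAt_pow (n + 1) t).mul (exp_neg_deriv t))
      refine h1.congr_deriv ?_
      push_cast
      ring)
    (Continuous.intervalIntegrable (by fun_prop) _ _)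
  have h0 : innerG n 0 = 0 := by simp [innerG]
  rw [innerG, h]; simp [h0]

lemma innerG_nonneg (n : ℕ) {x : ℝ} (hx : 0 ≤ x) : 0 ≤ innerG n x :=
  intervalIntegral.integral_nonneg hx fun t ht => mul_nonneg (pow_nonneg ht.1 _) (Real.exp_pos _).le

lemma innerG_le (n : ℕ) {x : ℝ} (hx : 0 ≤ x) : innerG n x ≤ n.factorial := by
  induction n with
  | zero => rw [innerG_zero]; simp; positivity
  | succ n ih =>
    rw [innerG_succ, Nat.factorial_succ]
    push_cast
    have : 0 ≤ x ^ (n + 1) * Real.exp (-x) := by positivity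
    have : ((n : ℝ) + 1) * innerG n x ≤ (n + 1) * n.factorial := by gcongr
    linarith

lemma pow_exp_int (k : ℕ) :
    IntegrableOn (fun x : ℝ => x ^ k * Real.exp (-x)) (Set.Ioi 0) := by
  have h := Real.GammaIntegral_convergent (s := (k : ℝ) + 1) (by positivity)
  refine h.congr_fun (fun x _ => ?_) measurableSet_Ioi
  simp [mul_comm]

lemma phi_int (m n : ℕ) :
    IntegrableOn (fun x : ℝ => x ^ m * Real.exp (-x) * innerG n x) (Set.Ioi 0) := by
  refine Integrable.mul_bdd (c := n.factorial) (pow_exp_int m)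
    (innerG_cont n).aestronglyMeasurable ?_
  filter_upwards [ae_restrict_mem measurableSet_Ioi] with x hx
  rw [Real.norm_of_nonneg (innerG_nonneg n (le_of_lt hx))]
  exact innerG_le n (le_of_lt hx)

lemma A_int (k : ℕ) :
    IntegrableOn (fun x : ℝ => x ^ k * Real.exp (-x) * Real.exp (-x)) (Set.Ioi 0) := by
  refine Integrable.mul_bdd (c := 1) (pow_exp_int k)
    (Continuous.aestronglyMeasurable (by fun_prop)) ?_
  filter_upwards [ae_restrict_mem measurableSet_Ioi] with x hx
  have hx' : (0 : ℝ) < x := hx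
  simp [hx'.le]

lemma A_eq (k : ℕ) :
    ∫ x in Set.Ioi (0 : ℝ), x ^ k * Real.exp (-x) * Real.exp (-x)
      = k.factorial / 2 ^ (k + 1) := by
  have h := Real.integral_rpow_mul_exp_neg_mul_Ioi (a := (k : ℝ) + 1) (r := 2)
    (by positivity) (by norm_num)
  rw [Real.Gamma_nat_eq_factorial] at h
  have e : ((k : ℝ) + 1) = ((k + 1 : ℕ) : ℝ) := by push_cast; rfl
  rw [show (1 / 2 : ℝ) ^ ((k : ℝ) + 1) = (1 / 2) ^ (k + 1) by rw [e, Real.rpow_natCast]] at h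
  rw [div_eq_mul_inv, mul_comm, ← inv_pow, ← one_div, ← h]
  refine setIntegral_congr_fun measurableSet_Ioi fun x _ => ?_
  simp only [add_sub_cancel_right, Real.rpow_natCast]
  rw [mul_assoc, ← Real.exp_add]
  ring_nf

lemma phi_right (m n : ℕ) :
    phi m (n + 1) = (n + 1) * phi m n - (m + n + 1).factorial / 2 ^ (m + n + 2) := by
  rw [← A_eq (m + n + 1)]
  change ∫ x in Set.Ioi (0 : ℝ), x ^ m * Real.exp (-x) * innerG (n + 1) x
    = (n + 1) * (∫ x in Set.Ioi (0 : ℝ), x ^ m * Real.exp (-x) * innerG n x) - _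
  rw [← integral_const_mul, ← integral_sub ((phi_int m n).const_mul _) (A_int _)]
  congr 1
  ext x
  rw [innerG_succ]
  ring

lemma phi_left (m n : ℕ) :
    phi (m + 1) n = (m + 1) * phi m n + (m + n + 1).factorial / 2 ^ (m + n + 2) := by
  have hint : IntegrableOn (fun x : ℝ => (m + 1) * (x ^ m * Real.exp (-x) * innerG n x)
      + x ^ (m + n + 1) * Real.exp (-x) * Real.exp (-x)
      - x ^ (m + 1) * Real.exp (-x) * innerG n x) (Set.Ioi 0) :=
    (((phi_int m n).const_mul _).add (A_int _)).sub (phi_int _ _)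
  have hd : ∀ x ∈ Set.Ici (0 : ℝ),
      HasDerivAt (fun x : ℝ => x ^ (m + 1) * Real.exp (-x) * innerG n x)
      ((m + 1) * (x ^ m * Real.exp (-x) * innerG n x)
      + x ^ (m + n + 1) * Real.exp (-x) * Real.exp (-x)
      - x ^ (m + 1) * Real.exp (-x) * innerG n x) x := by
    intro x _
    refine (((hasDerivAt_pow (m + 1) x).fun_mul (exp_neg_deriv x)).fun_mul
      (innerG_deriv n x)).congr_deriv ?_
    push_cast
    ring
  have ht := tendsto_zero_of_hasDerivAt_of_integrableOn_Ioi
    (fun x hx => hd x (Set.Ioi_subset_Ici_self hx)) hint (phi_int (m + 1) n)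
  have h := integral_Ioi_of_hasDerivAt_of_tendsto' hd hint ht
  have hs : IntegrableOn (fun x : ℝ => ((m : ℝ) + 1) * (x ^ m * Real.exp (-x) * innerG n x)
      + x ^ (m + n + 1) * Real.exp (-x) * Real.exp (-x)) (Set.Ioi 0) :=
    ((phi_int m n).const_mul _).add (A_int _)
  rw [integral_sub hs (phi_int _ _),
    integral_add ((phi_int m n).const_mul _) (A_int _), integral_const_mul, A_eq] at h
  change ∫ x in Set.Ioi (0 : ℝ), x ^ (m + 1) * Real.exp (-x) * innerG n x
    = (m + 1) * (∫ x in Set.Ioi (0 : ℝ), x ^ m * Real.exp (-x) * innerG n x) + _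
  simp at h
  linarith

/-- For all integers `m ≥ 1` and `n ≥ 1`,
`φ(m, n) = m·n·φ(m−1, n−1) − (m − n)·(m + n − 1)! / 2^{m+n+1}`. -/
theorem stmt6 (m n : ℕ) (hm : 1 ≤ m) (hn : 1 ≤ n) :
    phi m n = (m : ℝ) * n * phi (m - 1) (n - 1)
      - ((m : ℝ) - n) * (Nat.factorial (m + n - 1) : ℝ) / 2 ^ (m + n + 1) := by
  obtain ⟨m, rfl⟩ := Nat.exists_eq_add_of_le' hm
  obtain ⟨n, rfl⟩ := Nat.exists_eq_add_of_le' hn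
  rw [phi_left, phi_right]
  rw [show m + 1 + (n + 1) - 1 = m + n + 1 by omega,
    show m + (n + 1) + 1 = (m + n + 1) + 1 by omega, Nat.factorial_succ (m + n + 1),
    show m + (n + 1) + 2 = m + n + 3 by omega,
    show m + 1 + (n + 1) + 1 = m + n + 3 by omega]
  simp only [Nat.add_sub_cancel]
  push_cast
  rw [pow_succ 2 (m + n + 2)]
  field_simp
  ring
end

section
/- Let b > 0 and let α be real with 0 < α < 1. Define f : (0, ∞) → ℝ by f(K) = (K − 1)·log α + log(1 − 2^{−bK}), and set K* = (1/b)·log₂( 1 + b·(log 2)/log(1/α) ). Then f is strictly increasing on (0, K*) and strictly decreasing on (K*, ∞); in particular K* is the unique global maximizer of f on (0, ∞), and f′(K*) = 0. -/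
/-- Let `b > 0`, `0 < α < 1`, `f(K) = (K − 1)·log α + log(1 − 2^{−bK})` on `(0, ∞)`, and
`K* = (1/b)·log₂(1 + b·log 2 / log(1/α))`.  Then `f` is strictly increasing on `(0, K*)`
and strictly decreasing on `(K*, ∞)`; in particular `K*` is the unique global maximizer
of `f` on `(0, ∞)`, and `f′(K*) = 0`. -/
theorem stmt13 (b : ℝ) (hb : 0 < b) (α : ℝ) (hα0 : 0 < α) (hα1 : α < 1)
    (f : ℝ → ℝ)
    (hf : ∀ K : ℝ, f K = (K - 1) * Real.log α + Real.log (1 - (2 : ℝ) ^ (-(b * K))))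
    (Kstar : ℝ)
    (hKstar : Kstar = (1 / b) * Real.logb 2 (1 + b * Real.log 2 / Real.log (1 / α))) :
    StrictMonoOn f (Set.Ioo 0 Kstar) ∧ StrictAntiOn f (Set.Ioi Kstar) ∧
    (∀ K ∈ Set.Ioi (0 : ℝ), K ≠ Kstar → f K < f Kstar) ∧
    HasDerivAt f 0 Kstar := by
  set L : ℝ := -Real.log α with hL
  have hLpos : 0 < L := by
    have := Real.log_neg hα0 hα1
    linarith
  have hl2 : 0 < Real.log 2 := Real.log_pos (by norm_num)
  set c : ℝ := b * Real.log 2 with hc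
  have hcpos : 0 < c := mul_pos hb hl2
  have hlog1 : Real.log (1 / α) = L := by rw [one_div, Real.log_inv]
  have hcL : 0 < c / L := div_pos hcpos hLpos
  have hcK : c * Kstar = Real.log (1 + c / L) := by
    rw [hKstar, hlog1, hc, Real.logb]
    field_simp
  have hEs : Real.exp (c * Kstar) = 1 + c / L := by
    rw [hcK, Real.exp_log (by linarith)]
  have hKpos : 0 < Kstar := by
    have h : 0 < c * Kstar := by
      rw [hcK]; exact Real.log_pos (by linarith)
    exact (mul_pos_iff_of_pos_left hcpos).1 h
  have hf' : f = fun K : ℝ => (K - 1) * (-L) + Real.log (1 - Real.exp (-(c * K))) := by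
    funext K
    rw [hf K, Real.rpow_def_of_pos (by norm_num : (0:ℝ) < 2), hL, neg_neg, hc]
    congr 4
    ring
  have hder : ∀ K : ℝ, 0 < K → HasDerivAt f (c / (Real.exp (c * K) - 1) - L) K := by
    intro K hK
    have hE : 1 < Real.exp (c * K) := Real.one_lt_exp_iff.2 (mul_pos hcpos hK)
    have hE' : Real.exp (-(c * K)) < 1 := Real.exp_lt_one_iff.2 (by have := mul_pos hcpos hK; linarith)
    rw [hf']
    have h1 : HasDerivAt (fun K : ℝ => -(c * K)) (-(c * 1)) K :=
      ((hasDerivAt_id K).const_mul c).neg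
    have h2 := ((h1.exp.const_sub 1).log (sub_pos.2 hE').ne')
    have h3 : HasDerivAt (fun K : ℝ => (K - 1) * (-L)) (1 * (-L)) K :=
      ((hasDerivAt_id K).sub_const 1).mul_const (-L)
    refine (h3.add h2).congr_deriv ?_
    rw [Real.exp_neg]
    have hp := Real.exp_pos (c * K)
    have hq : Real.exp (c * K) - 1 ≠ 0 := (sub_pos.2 hE).ne'
    field_simp
    ring
  have hcont : ∀ K : ℝ, 0 < K → ContinuousAt f K := fun K hK => (hder K hK).continuousAt
  have hmono : StrictMonoOn f (Set.Ioc 0 Kstar) := by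
    apply strictMonoOn_of_deriv_pos (convex_Ioc 0 Kstar)
    · exact fun K hK => (hcont K hK.1).continuousWithinAt
    · intro K hK
      rw [interior_Ioc] at hK
      rw [(hder K hK.1).deriv, sub_pos]
      have hE : 1 < Real.exp (c * K) := Real.one_lt_exp_iff.2 (mul_pos hcpos hK.1)
      have hlt : Real.exp (c * K) < 1 + c / L := by
        rw [← hEs]; exact Real.exp_lt_exp.2 (mul_lt_mul_of_pos_left hK.2 hcpos)
      rw [lt_div_iff₀ (by linarith), mul_comm, ← lt_div_iff₀ hLpos]
      linarith
  have hanti : StrictAntiOn f (Set.Ici Kstar) := by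
    apply strictAntiOn_of_deriv_neg (convex_Ici Kstar)
    · exact fun K hK => (hcont K (hKpos.trans_le hK)).continuousWithinAt
    · intro K hK
      rw [interior_Ici] at hK
      have hK0 : 0 < K := hKpos.trans hK
      rw [(hder K hK0).deriv, sub_neg]
      have hE : 1 < Real.exp (c * K) := Real.one_lt_exp_iff.2 (mul_pos hcpos hK0)
      have hlt : 1 + c / L < Real.exp (c * K) := by
        rw [← hEs]; exact Real.exp_lt_exp.2 (mul_lt_mul_of_pos_left hK hcpos)
      rw [div_lt_iff₀ (by linarith), mul_comm, ← div_lt_iff₀ hLpos]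
      linarith
  refine ⟨hmono.mono Set.Ioo_subset_Ioc_self, hanti.mono Set.Ioi_subset_Ici_self, ?_, ?_⟩
  · intro K hK hne
    rcases lt_or_gt_of_ne hne with h | h
    · exact hmono ⟨hK, h.le⟩ ⟨hKpos, le_rfl⟩ h
    · exact hanti (Set.mem_Ici.2 le_rfl) (Set.mem_Ici.2 h.le) h
  · refine (hder Kstar hKpos).congr_deriv ?_
    rw [hEs, add_sub_cancel_left, div_div_cancel₀ hcpos.ne', sub_self]
end
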